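/- Let W be an exotic discrete memoryless channel with finite input alphabet X and finite output alphabet Y (in particular V_max = 0), and let ε = 1/2. Then there exists a constant K ∈ ℝ such that for all n ≥ 1, log M*(W^n, 1/2) ≤ n·C + (1/2)·log n + K, where C is the capacity of W. -/

import Mathlib

open Finset MeasureTheory

/-- `P` is a probability distribution on the finite set `Z`. -/
def IsDist {Z : Type*} [Fintype Z] (P : Z → ℝ) : Prop :=
  (∀ z, 0 ≤ P z) ∧ ∑ z, P z = 1

/-- `W` is a (discrete memoryless) channel from `X` to `Y`: a stochastic matrix. -/
def IsChannel {X Y : Type*} [Fintype X] [Fintype Y] (W : X → Y → ℝ) : Prop :=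
  ∀ x, IsDist (W x)

/-- Relative entropy `D(P‖Q) = Σ_z P(z) log (P(z)/Q(z))`. -/
noncomputable def relEnt {Z : Type*} [Fintype Z] (P Q : Z → ℝ) : ℝ :=
  ∑ z, P z * Real.log (P z / Q z)

/-- Divergence variance `V(P‖Q)`. -/
noncomputable def divVar {Z : Type*} [Fintype Z] (P Q : Z → ℝ) : ℝ :=
  ∑ z, P z * (Real.log (P z / Q z) - relEnt P Q) ^ 2

/-- Output distribution `PW`. -/
noncomputable def outDist {X Y : Type*} [Fintype X] (P : X → ℝ) (W : X → Y → ℝ) (y : Y) : ℝ :=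
  ∑ x, P x * W x y

/-- Mutual information `I(P,W) = Σ_x P(x) D(W(·|x)‖PW)`. -/
noncomputable def mutInfo {X Y : Type*} [Fintype X] [Fintype Y] (P : X → ℝ) (W : X → Y → ℝ) : ℝ :=
  ∑ x, P x * relEnt (W x) (outDist P W)

/-- Channel capacity `C = max_P I(P,W)`. -/
noncomputable def capacity {X Y : Type*} [Fintype X] [Fintype Y] (W : X → Y → ℝ) : ℝ :=
  sSup {c : ℝ | ∃ P : X → ℝ, IsDist P ∧ c = mutInfo P W}

/-- `P` is a capacity-achieving input distribution (member of `Π`). -/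
def isCAID {X Y : Type*} [Fintype X] [Fintype Y] (W : X → Y → ℝ) (P : X → ℝ) : Prop :=
  IsDist P ∧ mutInfo P W = capacity W

/-- Conditional information variance `V(P,W) = Σ_x P(x) V(W(·|x)‖PW)`. -/
noncomputable def infoVar {X Y : Type*} [Fintype X] [Fintype Y] (P : X → ℝ) (W : X → Y → ℝ) : ℝ :=
  ∑ x, P x * divVar (W x) (outDist P W)

/-- `V_min = min_{P ∈ Π} V(P,W)`. -/
noncomputable def Vmin {X Y : Type*} [Fintype X] [Fintype Y] (W : X → Y → ℝ) : ℝ :=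
  sInf {v : ℝ | ∃ P : X → ℝ, isCAID W P ∧ v = infoVar P W}

/-- `V_max = max_{P ∈ Π} V(P,W)`. -/
noncomputable def Vmax {X Y : Type*} [Fintype X] [Fintype Y] (W : X → Y → ℝ) : ℝ :=
  sSup {v : ℝ | ∃ P : X → ℝ, isCAID W P ∧ v = infoVar P W}

/-- The `ε`-channel dispersion `V_ε`. -/
noncomputable def Veps {X Y : Type*} [Fintype X] [Fintype Y] (W : X → Y → ℝ) (ε : ℝ) : ℝ :=
  if ε < 1/2 then Vmin W else Vmax W

/-- Average error probability of the code `(e, d)` with `M` messages for channel `V`. -/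
noncomputable def avgErr {A B : Type*} [Fintype B] {M : ℕ} (V : A → B → ℝ)
    (e : Fin M → A) (d : B → Fin M) : ℝ :=
  1 - (1 / (M : ℝ)) * ∑ m : Fin M, ∑ b ∈ Finset.univ.filter (fun b => d b = m), V (e m) b

/-- `M*(V,ε)`: the largest number of messages of a code with average error probability `≤ ε`. -/
noncomputable def Mstar {A B : Type*} [Fintype B] (V : A → B → ℝ) (ε : ℝ) : ℕ :=
  sSup {M : ℕ | ∃ e : Fin M → A, ∃ d : B → Fin M, avgErr V e d ≤ ε}

/-- `W` is exotic: `V_max = 0` and there is a symbol `x₀` with `D(W(·|x₀)‖Q*) = C` and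
`V(W(·|x₀)‖Q*) > 0`, where `Q* = PW` for any capacity-achieving input distribution `P`. -/
def IsExotic {X Y : Type*} [Fintype X] [Fintype Y] (W : X → Y → ℝ) : Prop :=
  Vmax W = 0 ∧ ∃ x₀ : X, ∀ P : X → ℝ, isCAID W P →
    relEnt (W x₀) (outDist P W) = capacity W ∧ 0 < divVar (W x₀) (outDist P W)

/-- The Gaussian tail integral `∫_k^∞ exp (-t²/2) dt`. -/
noncomputable def gaussTail (k : ℝ) : ℝ := ∫ t in Set.Ioi k, Real.exp (-t ^ 2 / 2)

/-- The Mills ratio of the standard Gaussian. -/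
noncomputable def millsRatio (k : ℝ) : ℝ := Real.exp (k ^ 2 / 2) * gaussTail k

lemma integrable_exp_neg_sq_div_two : Integrable (fun t : ℝ => Real.exp (-t ^ 2 / 2)) := by
  have h := integrable_exp_neg_mul_sq (b := 1 / 2) (by norm_num)
  refine h.congr (Filter.Eventually.of_forall fun t => ?_)
  dsimp only
  congr 1
  ring

lemma hasDerivAt_exp_neg_sq_div_two (t : ℝ) :
    HasDerivAt (fun t : ℝ => Real.exp (-t ^ 2 / 2)) (-t * Real.exp (-t ^ 2 / 2)) t := by
  have h : HasDerivAt (fun t : ℝ => -t ^ 2 / 2) (-t) t := by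
    refine (((hasDerivAt_pow 2 t).neg).div_const 2).congr_deriv ?_
    norm_num
    ring
  exact h.exp.congr_deriv (mul_comm _ _)

lemma hasDerivAt_gaussTail (k : ℝ) : HasDerivAt gaussTail (-Real.exp (-k ^ 2 / 2)) k := by
  have hcont : Continuous (fun t : ℝ => Real.exp (-t ^ 2 / 2)) := by fun_prop
  have heq : gaussTail = fun k => gaussTail 0 - ∫ t in (0 : ℝ)..k, Real.exp (-t ^ 2 / 2) := by
    funext k
    have := intervalIntegral.integral_Ioi_sub_Ioi'
      (integrable_exp_neg_sq_div_two.integrableOn (s := Set.Ioi (0 : ℝ)))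
      (integrable_exp_neg_sq_div_two.integrableOn (s := Set.Ioi k))
    simp only [gaussTail]
    linarith
  rw [heq]
  have := intervalIntegral.integral_hasDerivAt_right
    (hcont.intervalIntegrable 0 k) (hcont.stronglyMeasurableAtFilter _ _) hcont.continuousAt
  exact this.const_sub _

lemma gaussTail_pos (k : ℝ) : 0 < gaussTail k := by
  rw [gaussTail, setIntegral_pos_iff_support_of_nonneg_ae]
  · have : Function.support (fun t : ℝ => Real.exp (-t ^ 2 / 2)) = Set.univ := by
      ext t; simp [Real.exp_ne_zero]
    rw [this]; simp
  · exact Filter.Eventually.of_forall fun t => (Real.exp_pos _).le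
  · exact integrable_exp_neg_sq_div_two.integrableOn

lemma tendsto_exp_neg_sq_div_two :
    Filter.Tendsto (fun t : ℝ => Real.exp (-t ^ 2 / 2)) Filter.atTop (nhds 0) := by
  apply Real.tendsto_exp_atBot.comp
  have h : Filter.Tendsto (fun t : ℝ => t ^ 2 / 2) Filter.atTop Filter.atTop :=
    (Filter.tendsto_pow_atTop (by norm_num)).atTop_div_const (by norm_num)
  refine (Filter.tendsto_neg_atTop_atBot.comp h).congr fun t => ?_
  simp only [Function.comp]
  ring

lemma mul_gaussTail_le {k : ℝ} (hk : 0 ≤ k) : k * gaussTail k ≤ Real.exp (-k ^ 2 / 2) := by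
  have hderiv : ∀ t ∈ Set.Ici k,
      HasDerivAt (fun t : ℝ => -Real.exp (-t ^ 2 / 2)) (t * Real.exp (-t ^ 2 / 2)) t := by
    intro t _
    exact (hasDerivAt_exp_neg_sq_div_two t).neg.congr_deriv (by ring)
  have hlim : Filter.Tendsto (fun t : ℝ => -Real.exp (-t ^ 2 / 2)) Filter.atTop (nhds 0) := by
    simpa using tendsto_exp_neg_sq_div_two.neg
  have hpos : ∀ t ∈ Set.Ioi k, 0 ≤ t * Real.exp (-t ^ 2 / 2) := fun t ht =>
    mul_nonneg (hk.trans (le_of_lt ht)) (Real.exp_pos _).le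
  have hint := integrableOn_Ioi_deriv_of_nonneg' hderiv hpos hlim
  have heq := integral_Ioi_of_hasDerivAt_of_nonneg' hderiv hpos hlim
  rw [gaussTail, ← integral_const_mul]
  calc _ ≤ ∫ t in Set.Ioi k, t * Real.exp (-t ^ 2 / 2) := by
        refine setIntegral_mono_on (integrable_exp_neg_sq_div_two.integrableOn.const_mul k) hint
          measurableSet_Ioi fun t ht => ?_
        exact mul_le_mul_of_nonneg_right (le_of_lt ht) (Real.exp_pos _).le
    _ = _ := by rw [heq]; ring

lemma exp_neg_le_gaussTail {k : ℝ} (hk : 0 < k) :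
    k * Real.exp (-k ^ 2 / 2) ≤ (1 + k ^ 2) * gaussTail k := by
  have hderiv : ∀ t ∈ Set.Ici k, HasDerivAt (fun t : ℝ => -(Real.exp (-t ^ 2 / 2) / t))
      ((1 + 1 / t ^ 2) * Real.exp (-t ^ 2 / 2)) t := by
    intro t ht
    have ht0 : t ≠ 0 := (hk.trans_le ht).ne'
    refine ((hasDerivAt_exp_neg_sq_div_two t).div (hasDerivAt_id t) ht0).neg.congr_deriv ?_
    simp only [id]
    field_simp
    ring
  have hlim : Filter.Tendsto (fun t : ℝ => -(Real.exp (-t ^ 2 / 2) / t)) Filter.atTop (nhds 0) := by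
    simpa using (tendsto_exp_neg_sq_div_two.div_atTop Filter.tendsto_id).neg
  have hpos : ∀ t ∈ Set.Ioi k, 0 ≤ (1 + 1 / t ^ 2) * Real.exp (-t ^ 2 / 2) := fun t _ => by
    positivity
  have hint := integrableOn_Ioi_deriv_of_nonneg' hderiv hpos hlim
  have heq := integral_Ioi_of_hasDerivAt_of_nonneg' hderiv hpos hlim
  have hle : Real.exp (-k ^ 2 / 2) / k ≤ (1 + 1 / k ^ 2) * gaussTail k := by
    rw [gaussTail, ← integral_const_mul]
    calc _ = ∫ t in Set.Ioi k, (1 + 1 / t ^ 2) * Real.exp (-t ^ 2 / 2) := by rw [heq]; ring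
      _ ≤ _ := by
        refine setIntegral_mono_on hint (integrable_exp_neg_sq_div_two.integrableOn.const_mul _)
          measurableSet_Ioi fun t ht => ?_
        have : k < t := ht
        gcongr
  have := mul_le_mul_of_nonneg_left hle (sq_nonneg k)
  have e1 : k ^ 2 * (Real.exp (-k ^ 2 / 2) / k) = k * Real.exp (-k ^ 2 / 2) := by field_simp
  have e2 : k ^ 2 * ((1 + 1 / k ^ 2) * gaussTail k) = (1 + k ^ 2) * gaussTail k := by
    field_simp
    ring
  linarith

lemma exp_mul_exp_neg_sq (k : ℝ) : Real.exp (k ^ 2 / 2) * Real.exp (-k ^ 2 / 2) = 1 := by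
  rw [← Real.exp_add, neg_div, add_neg_cancel, Real.exp_zero]

lemma millsRatio_pos (k : ℝ) : 0 < millsRatio k := mul_pos (Real.exp_pos _) (gaussTail_pos k)

lemma mul_millsRatio_le_one {k : ℝ} (hk : 0 ≤ k) : k * millsRatio k ≤ 1 := by
  have h := mul_le_mul_of_nonneg_left (mul_gaussTail_le hk) (Real.exp_pos (k ^ 2 / 2)).le
  rw [exp_mul_exp_neg_sq] at h
  rw [millsRatio]
  linarith

lemma le_sq_mul_millsRatio {k : ℝ} (hk : 0 < k) : k ≤ (1 + k ^ 2) * millsRatio k := by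
  have h := mul_le_mul_of_nonneg_left (exp_neg_le_gaussTail hk) (Real.exp_pos (k ^ 2 / 2)).le
  have e := exp_mul_exp_neg_sq k
  rw [millsRatio]
  calc k = Real.exp (k ^ 2 / 2) * (k * Real.exp (-k ^ 2 / 2)) := by linear_combination (-k) * e
    _ ≤ _ := h
    _ = _ := by ring

lemma hasDerivAt_millsRatio (k : ℝ) : HasDerivAt millsRatio (k * millsRatio k - 1) k := by
  have h : HasDerivAt (fun t : ℝ => t ^ 2 / 2) k k := by
    exact ((hasDerivAt_pow 2 k).div_const 2).congr_deriv (by norm_num)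
  refine (h.exp.mul (hasDerivAt_gaussTail k)).congr_deriv ?_
  rw [millsRatio]
  linear_combination (-1) * exp_mul_exp_neg_sq k

lemma continuous_millsRatio : Continuous millsRatio :=
  continuous_iff_continuousAt.2 fun k => (hasDerivAt_millsRatio k).continuousAt

lemma antitoneOn_millsRatio : AntitoneOn millsRatio (Set.Ici 0) := by
  refine antitoneOn_of_deriv_nonpos (convex_Ici 0) continuous_millsRatio.continuousOn
    (fun k _ => (hasDerivAt_millsRatio k).differentiableAt.differentiableWithinAt) fun k hk => ?_
  rw [interior_Ici] at hk
  rw [(hasDerivAt_millsRatio k).deriv]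
  linarith [mul_millsRatio_le_one (le_of_lt hk)]

lemma monotoneOn_mul_millsRatio : MonotoneOn (fun k => k * millsRatio k) (Set.Ici 0) := by
  have hd : ∀ k, HasDerivAt (fun k => k * millsRatio k)
      (1 * millsRatio k + k * (k * millsRatio k - 1)) k := fun k =>
    (hasDerivAt_id k).mul (hasDerivAt_millsRatio k)
  refine monotoneOn_of_deriv_nonneg (convex_Ici 0)
    (continuous_id.mul continuous_millsRatio).continuousOn
    (fun k _ => (hd k).differentiableAt.differentiableWithinAt) fun k hk => ?_
  rw [interior_Ici] at hk
  rw [(hd k).deriv]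
  linarith [le_sq_mul_millsRatio hk]

/-- The odd extension of `k ↦ k * millsRatio k` is nondecreasing and Lipschitz. -/
lemma mul_millsRatio_abs_sub_le {a b : ℝ} (hab : a ≤ b) :
    a * millsRatio |a| ≤ b * millsRatio |b| ∧
      b * millsRatio |b| - a * millsRatio |a| ≤ millsRatio 0 * (b - a) := by
  have key : ∀ {u v : ℝ}, 0 ≤ u → u ≤ v → u * millsRatio u ≤ v * millsRatio v ∧
      v * millsRatio v - u * millsRatio u ≤ millsRatio 0 * (v - u) := by
    intro u v hu huv
    have hv := hu.trans huv
    refine ⟨monotoneOn_mul_millsRatio hu hv huv, ?_⟩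
    have h1 := antitoneOn_millsRatio hu hv huv
    have h2 := antitoneOn_millsRatio (Set.mem_Ici.2 le_rfl) hv hv
    nlinarith [mul_le_mul_of_nonneg_left h1 hu, mul_le_mul_of_nonneg_left h2 (sub_nonneg.2 huv)]
  rcases le_total 0 a with ha | ha
  · rw [abs_of_nonneg ha, abs_of_nonneg (ha.trans hab)]
    exact key ha hab
  rcases le_total 0 b with hb | hb
  · rw [abs_of_nonpos ha, abs_of_nonneg hb]
    have h1 := key le_rfl hb
    have h2 := key le_rfl (neg_nonneg.2 ha)
    constructor <;> linarith [h1.1, h1.2, h2.1, h2.2]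
  · rw [abs_of_nonpos ha, abs_of_nonpos hb]
    have h := key (neg_nonneg.2 hb) (neg_le_neg hab)
    constructor <;> linarith [h.1, h.2]

/-- Solution of Stein's equation for the half-line `(0, ∞)`. -/
noncomputable def steinSol (k : ℝ) : ℝ := -(millsRatio |k|) / 2

lemma mul_le_steinSol_sub_of_nonneg {a b r : ℝ} (ha : 0 ≤ a) (hab : a ≤ b)
    (hr : ∀ u ∈ Set.Icc a b, r ≤ u * steinSol u + 1 / 2) :
    r * (b - a) ≤ steinSol b - steinSol a := by
  have hd : ∀ u, HasDerivAt (fun u => -(millsRatio u) / 2) (-(u * millsRatio u - 1) / 2) u :=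
    fun u => (hasDerivAt_millsRatio u).neg.div_const 2
  have h := (convex_Icc a b).mul_sub_le_image_sub_of_le_deriv
    (f := fun u => -(millsRatio u) / 2) (C := r)
    (fun u _ => (hd u).continuousAt.continuousWithinAt)
    (fun u _ => (hd u).differentiableAt.differentiableWithinAt)
    (fun u hu => by
      have hu' := interior_subset hu
      rw [(hd u).deriv]
      have := hr u hu'
      rw [steinSol, abs_of_nonneg (ha.trans hu'.1)] at this
      linarith)
    a (Set.left_mem_Icc.2 hab) b (Set.right_mem_Icc.2 hab) hab
  simpa only [steinSol, abs_of_nonneg ha, abs_of_nonneg (ha.trans hab)] using h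

lemma mul_le_steinSol_sub_of_nonpos {a b r : ℝ} (hb : b ≤ 0) (hab : a ≤ b)
    (hr : ∀ u ∈ Set.Icc a b, r ≤ u * steinSol u - 1 / 2) :
    r * (b - a) ≤ steinSol b - steinSol a := by
  have hd : ∀ u, HasDerivAt (fun u => -(millsRatio (-u)) / 2)
      (-(-(-u * millsRatio (-u) - 1)) / 2) u := fun u => by
    have h := (hasDerivAt_millsRatio (-u)).comp u (hasDerivAt_neg u)
    rw [mul_neg_one] at h
    exact h.neg.div_const 2
  have h := (convex_Icc a b).mul_sub_le_image_sub_of_le_deriv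
    (f := fun u => -(millsRatio (-u)) / 2) (C := r)
    (fun u _ => (hd u).continuousAt.continuousWithinAt)
    (fun u _ => (hd u).differentiableAt.differentiableWithinAt)
    (fun u hu => by
      have hu' := interior_subset hu
      rw [(hd u).deriv]
      have := hr u hu'
      rw [steinSol, abs_of_nonpos (hu'.2.trans hb)] at this
      linarith)
    a (Set.left_mem_Icc.2 hab) b (Set.right_mem_Icc.2 hab) hab
  simpa only [steinSol, abs_of_nonpos hb, abs_of_nonpos (hab.trans hb)] using h

/-- Lower bound for the slopes of `steinSol` in the `η`-neighbourhood of `k`. -/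
lemma sq_mul_le_steinSol_slope {k η a b : ℝ} (hη : 0 ≤ η) (ha : |a - k| ≤ η) (hb : |b - k| ≤ η) :
    (b - a) ^ 2 * (k * steinSol k + (if η < k then 1 else 0) - 1 / 2 - millsRatio 0 * η / 2) ≤
      (b - a) * (steinSol b - steinSol a) := by
  wlog hab : a ≤ b generalizing a b
  · have := this hb ha (le_of_not_ge hab)
    linarith
  have hN := (millsRatio_pos 0).le
  rw [abs_le] at ha hb
  have hlip : ∀ u ∈ Set.Icc a b,
      k * steinSol k - millsRatio 0 * η / 2 ≤ u * steinSol u := by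
    intro u hu
    simp only [steinSol]
    rcases le_total u k with h | h
    · have := (mul_millsRatio_abs_sub_le h).1
      nlinarith [mul_nonneg hN hη]
    · have h1 := (mul_millsRatio_abs_sub_le h).2
      have h2 : u - k ≤ η := by linarith [hu.2]
      nlinarith [mul_le_mul_of_nonneg_left h2 hN]
  suffices h : (k * steinSol k + (if η < k then 1 else 0) - 1 / 2 - millsRatio 0 * η / 2) * (b - a)
      ≤ steinSol b - steinSol a by
    have := mul_le_mul_of_nonneg_left h (sub_nonneg.2 hab)
    linarith
  split_ifs with hk
  · exact mul_le_steinSol_sub_of_nonneg (by linarith) hab fun u hu => by linarith [hlip u hu]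
  · rcases le_total 0 a with h0 | h0
    · exact mul_le_steinSol_sub_of_nonneg h0 hab fun u hu => by linarith [hlip u hu]
    rcases le_total b 0 with h1 | h1
    · exact mul_le_steinSol_sub_of_nonpos h1 hab fun u hu => by linarith [hlip u hu]
    · have e1 := mul_le_steinSol_sub_of_nonpos
        (r := k * steinSol k + 0 - 1 / 2 - millsRatio 0 * η / 2) le_rfl h0 fun u hu => by
          linarith [hlip u ⟨hu.1, hu.2.trans h1⟩]
      have e2 := mul_le_steinSol_sub_of_nonneg
        (r := k * steinSol k + 0 - 1 / 2 - millsRatio 0 * η / 2) le_rfl h1 fun u hu => by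
          linarith [hlip u ⟨h0.trans hu.1, hu.2⟩]
      linarith

/-- A quadratic lower bound for the Mills ratio. -/
lemma millsRatio_two_mul_le (k : ℝ) : millsRatio 2 * (1 - k ^ 2 / 4) ≤ millsRatio |k| := by
  have h2 := millsRatio_pos 2
  rcases le_total |k| 2 with h | h
  · have := antitoneOn_millsRatio (Set.mem_Ici.2 (abs_nonneg k)) (by norm_num) h
    nlinarith [sq_nonneg k]
  · have : 4 ≤ k ^ 2 := by rw [← sq_abs]; nlinarith
    nlinarith [millsRatio_pos |k|]

/-- Expectation of `G` under the product of the weights `w i`. -/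
noncomputable def prodExp {ι Z : Type*} [Fintype ι] [DecidableEq ι] [Fintype Z]
    (w : ι → Z → ℝ) (G : (ι → Z) → ℝ) : ℝ :=
  ∑ ys, (∏ i, w i (ys i)) * G ys

section ProdExp

variable {ι Z : Type*} [Fintype ι] [DecidableEq ι] [Fintype Z] {w ξ : ι → Z → ℝ}

lemma prodExp_add (G H : (ι → Z) → ℝ) :
    prodExp w (fun ys => G ys + H ys) = prodExp w G + prodExp w H := by
  simp only [prodExp, mul_add, Finset.sum_add_distrib]

lemma prodExp_const_mul (a : ℝ) (G : (ι → Z) → ℝ) :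
    prodExp w (fun ys => a * G ys) = a * prodExp w G := by
  simp only [prodExp, Finset.mul_sum]
  exact Finset.sum_congr rfl fun ys _ => by ring

lemma prodExp_sum {κ : Type*} (s : Finset κ) (G : κ → (ι → Z) → ℝ) :
    prodExp w (fun ys => ∑ j ∈ s, G j ys) = ∑ j ∈ s, prodExp w (G j) := by
  simp only [prodExp, Finset.mul_sum]
  exact Finset.sum_comm

lemma prodExp_mono (hw : ∀ i, IsDist (w i)) {G H : (ι → Z) → ℝ} (h : ∀ ys, G ys ≤ H ys) :
    prodExp w G ≤ prodExp w H :=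
  Finset.sum_le_sum fun ys _ =>
    mul_le_mul_of_nonneg_left (h ys) (Finset.prod_nonneg fun i _ => (hw i).1 _)

lemma sum_prod_eq_one (hw : ∀ i, IsDist (w i)) : ∑ ys : ι → Z, ∏ i, w i (ys i) = 1 := by
  rw [← Fintype.prod_sum]
  exact Finset.prod_eq_one fun i _ => (hw i).2

lemma prodExp_const (hw : ∀ i, IsDist (w i)) (a : ℝ) : prodExp w (fun _ => a) = a := by
  rw [prodExp, ← Finset.sum_mul, sum_prod_eq_one hw, one_mul]

/-- Resampling one coordinate does not change an expectation under a product distribution. -/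
lemma prodExp_resample (hw : ∀ i, IsDist (w i)) (i : ι) (G : (ι → Z) → ℝ) :
    prodExp w G = prodExp w (fun ys => ∑ z, w i z * G (Function.update ys i z)) := by
  let σ : (ι → Z) × Z → (ι → Z) × Z := fun q => (Function.update q.1 i q.2, q.1 i)
  have hσ : Function.Involutive σ := fun q => by simp [σ]
  have hwt : ∀ q : (ι → Z) × Z, (∏ j, w j ((σ q).1 j)) * w i (σ q).2 =
      (∏ j, w j (q.1 j)) * w i q.2 := by
    intro q
    have h : ∏ j ∈ univ.erase i, w j (Function.update q.1 i q.2 j) =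
        ∏ j ∈ univ.erase i, w j (q.1 j) :=
      Finset.prod_congr rfl fun j hj => by rw [Function.update_of_ne (Finset.ne_of_mem_erase hj)]
    rw [← Finset.mul_prod_erase univ (fun j => w j ((σ q).1 j)) (Finset.mem_univ i),
      ← Finset.mul_prod_erase univ (fun j => w j (q.1 j)) (Finset.mem_univ i)]
    simp only [σ, Function.update_self, h]
    ring
  calc prodExp w G = ∑ q : (ι → Z) × Z, ((∏ j, w j (q.1 j)) * w i q.2) * G q.1 := by
        rw [Fintype.sum_prod_type]
        refine Finset.sum_congr rfl fun ys _ => ?_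
        dsimp only
        rw [← Finset.sum_mul, ← Finset.mul_sum, (hw i).2, mul_one]
    _ = ∑ q : (ι → Z) × Z, ((∏ j, w j (q.1 j)) * w i q.2) * G (σ q).1 := by
        rw [← hσ.bijective.sum_comp]
        exact Finset.sum_congr rfl fun q _ => by rw [hwt]
    _ = _ := by
        rw [Fintype.sum_prod_type, prodExp]
        refine Finset.sum_congr rfl fun ys _ => ?_
        rw [Finset.mul_sum]
        exact Finset.sum_congr rfl fun z _ => by simp only [σ]; ring

lemma prodExp_mul_resample (hw : ∀ i, IsDist (w i)) (hmean : ∀ i, ∑ z, w i z * ξ i z = 0) (i : ι)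
    (f : ℝ → ℝ) :
    prodExp w (fun ys => ξ i (ys i) * f (∑ j, ξ j (ys j))) =
      prodExp w (fun ys => ∑ z, w i z * (ξ i z *
        (f (∑ j, ξ j (ys j) - ξ i (ys i) + ξ i z) - f (∑ j, ξ j (ys j) - ξ i (ys i))))) := by
  rw [prodExp_resample hw i]
  congr 1
  funext ys
  have hupd : ∀ z, ∑ j, ξ j (Function.update ys i z j) =
      ∑ j, ξ j (ys j) - ξ i (ys i) + ξ i z := by
    intro z
    have h : ∑ j ∈ univ.erase i, ξ j (Function.update ys i z j) =
        ∑ j ∈ univ.erase i, ξ j (ys j) :=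
      Finset.sum_congr rfl fun j hj => by rw [Function.update_of_ne (Finset.ne_of_mem_erase hj)]
    rw [← Finset.add_sum_erase univ (fun j => ξ j (Function.update ys i z j)) (Finset.mem_univ i),
      ← Finset.add_sum_erase univ (fun j => ξ j (ys j)) (Finset.mem_univ i), h]
    simp only [Function.update_self]
    ring
  simp only [Function.update_self, hupd, mul_sub, Finset.sum_sub_distrib]
  have h0 : ∑ z, w i z * (ξ i z * f (∑ j, ξ j (ys j) - ξ i (ys i))) = 0 := by
    simp only [← mul_assoc]
    rw [← Finset.sum_mul, hmean i, zero_mul]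
  rw [h0, sub_zero]

lemma prodExp_sum_mul (f : ℝ → ℝ) :
    prodExp w (fun ys => (∑ j, ξ j (ys j)) * f (∑ j, ξ j (ys j))) =
      ∑ i, prodExp w (fun ys => ξ i (ys i) * f (∑ j, ξ j (ys j))) := by
  rw [← prodExp_sum]
  simp only [Finset.sum_mul]

lemma prodExp_sum_sq (hw : ∀ i, IsDist (w i)) (hmean : ∀ i, ∑ z, w i z * ξ i z = 0) :
    prodExp w (fun ys => (∑ j, ξ j (ys j)) ^ 2) = ∑ i, ∑ z, w i z * ξ i z ^ 2 := by
  have h := prodExp_sum_mul (w := w) (ξ := ξ) (fun s => s)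
  simp only [← pow_two] at h
  rw [h]
  refine Finset.sum_congr rfl fun i _ => ?_
  rw [prodExp_mul_resample hw hmean i fun s => s]
  simp only [add_sub_cancel_left, ← pow_two]
  exact prodExp_const hw _

lemma prodExp_sum_eq_zero (hw : ∀ i, IsDist (w i)) (hmean : ∀ i, ∑ z, w i z * ξ i z = 0) :
    prodExp w (fun ys => ∑ j, ξ j (ys j)) = 0 := by
  have h := prodExp_sum_mul (w := w) (ξ := ξ) (fun _ => 1)
  simp only [mul_one] at h
  rw [h]
  refine Finset.sum_eq_zero fun i _ => ?_
  have := prodExp_mul_resample hw hmean i fun _ => 1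
  simp only [mul_one, sub_self, mul_zero, Finset.sum_const_zero] at this
  rw [this]
  exact prodExp_const hw 0

/-- Stein-type inequality: if `ℓ s` bounds the slopes of `f` near `s` from below, then
`Var S * E ℓ(S) ≤ E [S f(S)]` for a sum `S` of independent bounded centred variables. -/
lemma variance_mul_prodExp_le (hw : ∀ i, IsDist (w i)) (hmean : ∀ i, ∑ z, w i z * ξ i z = 0)
    {L : ℝ} (hL : ∀ i z, |ξ i z| ≤ L) {f ℓ : ℝ → ℝ}
    (hf : ∀ s a b, |a - s| ≤ 2 * L → |b - s| ≤ 2 * L →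
      (b - a) ^ 2 * ℓ s ≤ (b - a) * (f b - f a)) :
    (∑ i, ∑ z, w i z * ξ i z ^ 2) * prodExp w (fun ys => ℓ (∑ j, ξ j (ys j))) ≤
      prodExp w (fun ys => (∑ j, ξ j (ys j)) * f (∑ j, ξ j (ys j))) := by
  rw [prodExp_sum_mul, Finset.sum_mul]
  refine Finset.sum_le_sum fun i _ => ?_
  rw [prodExp_mul_resample hw hmean, ← prodExp_const_mul]
  refine prodExp_mono hw fun ys => ?_
  rw [Finset.sum_mul]
  refine Finset.sum_le_sum fun z _ => ?_
  rw [mul_assoc]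
  refine mul_le_mul_of_nonneg_left ?_ ((hw i).1 z)
  have h1 := abs_le.1 (hL i (ys i))
  have h2 := abs_le.1 (hL i z)
  have := hf (∑ j, ξ j (ys j)) (∑ j, ξ j (ys j) - ξ i (ys i))
    (∑ j, ξ j (ys j) - ξ i (ys i) + ξ i z)
    (abs_le.2 ⟨by linarith, by linarith⟩) (abs_le.2 ⟨by linarith, by linarith⟩)
  simpa only [add_sub_cancel_left] using this

/-- Gaussian comparison near the mean for a sum of independent bounded centred variables. -/
lemma prodExp_tail_le_of_large_variance (hw : ∀ i, IsDist (w i))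
    (hmean : ∀ i, ∑ z, w i z * ξ i z = 0) {L : ℝ} (hL0 : 0 ≤ L) (hL : ∀ i z, |ξ i z| ≤ L)
    {B c : ℝ} (hB : 0 < B) (hV : ∑ i, ∑ z, w i z * ξ i z ^ 2 = B ^ 2) (hc : 0 ≤ c) (hcB : c ≤ B) :
    prodExp w (fun ys => if c + 2 * L < ∑ j, ξ j (ys j) then 1 else 0) ≤
      1 / 2 - (c * millsRatio 2 / 4 - millsRatio 0 * L) / B := by
  set η : ℝ := 2 * L / B with hη
  have hη0 : 0 ≤ η := by positivity
  let f : ℝ → ℝ := fun s => steinSol ((s - c) / B) / B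
  let ℓ : ℝ → ℝ := fun s => ((s - c) / B * steinSol ((s - c) / B) +
    (if η < (s - c) / B then 1 else 0) - 1 / 2 - millsRatio 0 * η / 2) / B ^ 2
  have hslope : ∀ s a b, |a - s| ≤ 2 * L → |b - s| ≤ 2 * L →
      (b - a) ^ 2 * ℓ s ≤ (b - a) * (f b - f a) := by
    have hnear : ∀ a s, |a - s| ≤ 2 * L → |(a - c) / B - (s - c) / B| ≤ η := by
      intro a s h
      rw [← sub_div, sub_sub_sub_cancel_right, abs_div, abs_of_pos hB]
      exact div_le_div_of_nonneg_right h hB.le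
    intro s a b ha hb
    have h := sq_mul_le_steinSol_slope hη0 (hnear a s ha) (hnear b s hb)
    rw [← sub_div, sub_sub_sub_cancel_right] at h
    simp only [f, ℓ]
    calc _ = _ := by rw [← mul_div_assoc, ← div_mul_eq_mul_div, ← div_pow]
      _ ≤ _ := h
      _ = _ := by rw [← sub_div]; ring
  have hst := variance_mul_prodExp_le hw hmean hL hslope
  rw [hV, ← prodExp_const_mul] at hst
  have hpt : ∀ s : ℝ, (if c + 2 * L < s then (1 : ℝ) else 0) + (s * f s + (-(1 / 2) -
      millsRatio 0 * η / 2 + (c / (2 * B) * (millsRatio 2 * (1 - (c ^ 2) / (4 * B ^ 2))) +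
      (c / (2 * B) * (millsRatio 2 * (2 * c / (4 * B ^ 2))) * s
        + -(c / (2 * B) * (millsRatio 2 / (4 * B ^ 2))) * s ^ 2)))) ≤ B ^ 2 * ℓ s := by
    intro s
    have hif : (η < (s - c) / B) ↔ c + 2 * L < s := by
      rw [hη, div_lt_div_iff_of_pos_right hB]
      constructor <;> intro h <;> linarith
    have hm := millsRatio_two_mul_le ((s - c) / B)
    have hm' := mul_le_mul_of_nonneg_left hm (div_nonneg hc (by positivity : 0 ≤ 2 * B))
    have e : B ^ 2 * ℓ s = s * f s + c / (2 * B) * millsRatio |(s - c) / B| +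
        (if c + 2 * L < s then 1 else 0) - 1 / 2 - millsRatio 0 * η / 2 := by
      simp only [ℓ, f, hif]
      rw [mul_div_cancel₀ _ (pow_ne_zero 2 hB.ne')]
      simp only [steinSol]
      ring
    have e2 : c / (2 * B) * (millsRatio 2 * (1 - ((s - c) / B) ^ 2 / 4)) =
        c / (2 * B) * (millsRatio 2 * (1 - (c ^ 2) / (4 * B ^ 2))) +
        (c / (2 * B) * (millsRatio 2 * (2 * c / (4 * B ^ 2))) * s
        + -(c / (2 * B) * (millsRatio 2 / (4 * B ^ 2))) * s ^ 2) := by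
      field_simp
      ring
    linarith
  have hint := (prodExp_mono hw fun ys => hpt (∑ j, ξ j (ys j))).trans hst
  simp only [prodExp_add, prodExp_const_mul, prodExp_const hw, prodExp_sum_sq hw hmean,
    prodExp_sum_eq_zero hw hmean, hV] at hint
  have hgain : c * millsRatio 2 / 4 / B ≤
      c / (2 * B) * (millsRatio 2 * (1 - (c ^ 2) / (4 * B ^ 2))) +
      -(c / (2 * B) * (millsRatio 2 / (4 * B ^ 2))) * B ^ 2 := by
    have h1 : c ^ 2 / B ^ 2 ≤ 1 := by
      rw [div_le_one (by positivity)]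
      gcongr
    have h2 : 0 ≤ c / (2 * B) * millsRatio 2 :=
      mul_nonneg (by positivity) (millsRatio_pos 2).le
    have e : c / (2 * B) * (millsRatio 2 * (1 - (c ^ 2) / (4 * B ^ 2))) +
      -(c / (2 * B) * (millsRatio 2 / (4 * B ^ 2))) * B ^ 2 =
      c / (2 * B) * millsRatio 2 * (3 / 4 - (c ^ 2 / B ^ 2) / 4) := by
      field_simp
      ring
    rw [e]
    calc c * millsRatio 2 / 4 / B = c / (2 * B) * millsRatio 2 * (1 / 2) := by
          field_simp
          ring
      _ ≤ _ := mul_le_mul_of_nonneg_left (by linarith) h2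
  have e : (c * millsRatio 2 / 4 - millsRatio 0 * L) / B =
      c * millsRatio 2 / 4 / B - millsRatio 0 * η / 2 := by
    rw [hη]
    field_simp
  rw [e]
  linarith

lemma prodExp_tail_le_of_variance_le (hw : ∀ i, IsDist (w i))
    (hmean : ∀ i, ∑ z, w i z * ξ i z = 0) {V c : ℝ} (hc : 0 < c)
    (hV : ∑ i, ∑ z, w i z * ξ i z ^ 2 ≤ V) :
    prodExp w (fun ys => if c < ∑ j, ξ j (ys j) then 1 else 0) ≤ V / c ^ 2 := by
  calc _ ≤ prodExp w (fun ys => 1 / c ^ 2 * (∑ j, ξ j (ys j)) ^ 2) := by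
        refine prodExp_mono hw fun ys => ?_
        split_ifs with h
        · rw [one_div_mul_eq_div, one_le_div (by positivity)]
          gcongr
        · positivity
    _ = 1 / c ^ 2 * ∑ i, ∑ z, w i z * ξ i z ^ 2 := by
        rw [prodExp_const_mul, prodExp_sum_sq hw hmean]
    _ ≤ _ := by
        rw [one_div_mul_eq_div]
        gcongr

end ProdExp

/-- A uniform bound on the upper tail of sums of independent bounded centred variables, a constant
above the mean: it stays below one half by a margin of order `1 / √n`. -/
lemma exists_prodExp_tail_le {Z : Type*} [Fintype Z] (L : ℝ) :
    ∃ c : ℝ, ∀ n : ℕ, 1 ≤ n → ∀ w ξ : Fin n → Z → ℝ, (∀ i, IsDist (w i)) →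
      (∀ i, ∑ z, w i z * ξ i z = 0) → (∀ i z, |ξ i z| ≤ L) →
      prodExp w (fun ys => if c < ∑ j, ξ j (ys j) then 1 else 0) ≤
        1 / 2 - 1 / (4 * Real.sqrt n) := by
  wlog hL1 : 1 ≤ L generalizing L
  · obtain ⟨c, hc⟩ := this 1 le_rfl
    exact ⟨c, fun n hn w ξ hw hm hL => hc n hn w ξ hw hm fun i z =>
      (hL i z).trans (le_of_not_ge hL1)⟩
  have hN2 := millsRatio_pos 2
  have hN0 := millsRatio_pos 0
  set c : ℝ := 4 * (millsRatio 0 * L + L) / millsRatio 2 with hc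
  have hc0 : 0 < c := by positivity
  refine ⟨2 * c + 2 * L, fun n hn w ξ hw hmean hL => ?_⟩
  have hn' : (1 : ℝ) ≤ Real.sqrt n := by
    rw [Real.one_le_sqrt]
    exact_mod_cast hn
  set V := ∑ i, ∑ z, w i z * ξ i z ^ 2 with hV
  have hV0 : 0 ≤ V := Finset.sum_nonneg fun i _ => Finset.sum_nonneg fun z _ =>
    mul_nonneg ((hw i).1 z) (sq_nonneg _)
  have hVn : V ≤ n * L ^ 2 := by
    calc V ≤ ∑ _i : Fin n, L ^ 2 := by
          refine Finset.sum_le_sum fun i _ => ?_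
          calc _ ≤ ∑ z, w i z * L ^ 2 := by
                refine Finset.sum_le_sum fun z _ => ?_
                refine mul_le_mul_of_nonneg_left ?_ ((hw i).1 z)
                exact sq_le_sq' (abs_le.1 (hL i z)).1 (abs_le.1 (hL i z)).2
            _ = _ := by rw [← Finset.sum_mul, (hw i).2, one_mul]
      _ = _ := by simp
  rcases le_total c (Real.sqrt V) with h | h
  · have hB : 0 < Real.sqrt V := hc0.trans_le h
    have hb := prodExp_tail_le_of_large_variance hw hmean (by linarith) hL hB
      (hV.symm.trans (Real.sq_sqrt hV0).symm) hc0.le h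
    have e : c * millsRatio 2 / 4 - millsRatio 0 * L = L := by
      rw [hc]
      field_simp
      ring
    rw [e] at hb
    have hBn : Real.sqrt V ≤ Real.sqrt n * L := by
      rw [Real.sqrt_le_left (by positivity), mul_pow, Real.sq_sqrt (Nat.cast_nonneg n)]
      exact hVn
    have hmargin : 1 / (4 * Real.sqrt n) ≤ L / Real.sqrt V := by
      rw [div_le_div_iff₀ (by positivity) hB]
      nlinarith
    have hmono : prodExp w (fun ys => if 2 * c + 2 * L < ∑ j, ξ j (ys j) then (1 : ℝ) else 0) ≤
        prodExp w (fun ys => if c + 2 * L < ∑ j, ξ j (ys j) then (1 : ℝ) else 0) := by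
      refine prodExp_mono hw fun ys => ?_
      split_ifs <;> linarith
    linarith
  · have hVc : V ≤ c ^ 2 := (Real.sqrt_le_left hc0.le).1 h
    have hb := prodExp_tail_le_of_variance_le hw hmean (c := 2 * c + 2 * L) (by linarith) hVc
    have h1 : c ^ 2 / (2 * c + 2 * L) ^ 2 ≤ 1 / 4 := by
      rw [div_le_div_iff₀ (by positivity) (by norm_num)]
      nlinarith
    have h2 : 1 / (4 * Real.sqrt n) ≤ 1 / 4 := by
      rw [div_le_div_iff₀ (by positivity) (by norm_num)]
      linarith
    linarith

section Capacity

variable {X Y : Type*} [Fintype X] [Fintype Y] {W : X → Y → ℝ} {P : X → ℝ}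

lemma isDist_outDist (hW : IsChannel W) (hP : IsDist P) : IsDist (outDist P W) := by
  refine ⟨fun y => Finset.sum_nonneg fun x _ => mul_nonneg (hP.1 x) ((hW x).1 y), ?_⟩
  simp only [outDist]
  rw [Finset.sum_comm]
  simp only [← Finset.mul_sum, (hW _).2, mul_one]
  exact hP.2

lemma outDist_pos (hW : IsChannel W) (hP : IsDist P) {x : X} {y : Y} (hx : 0 < P x)
    (hy : 0 < W x y) : 0 < outDist P W y :=
  (mul_pos hx hy).trans_le <| Finset.single_le_sum (f := fun x => P x * W x y)
    (fun x _ => mul_nonneg (hP.1 x) ((hW x).1 y)) (Finset.mem_univ x)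

lemma IsDist.le_one {Z : Type*} [Fintype Z] {Q : Z → ℝ} (hQ : IsDist Q) (z : Z) : Q z ≤ 1 :=
  hQ.2 ▸ Finset.single_le_sum (fun z _ => hQ.1 z) (Finset.mem_univ z)

/-- Mutual information as output entropy minus conditional entropy. -/
lemma mutInfo_eq (hW : IsChannel W) (hP : IsDist P) :
    mutInfo P W = ∑ x, P x * ∑ y, W x y * Real.log (W x y) +
      ∑ y, Real.negMulLog (outDist P W y) := by
  have h : ∑ y, Real.negMulLog (outDist P W y) =
      ∑ x, P x * ∑ y, -(W x y * Real.log (outDist P W y)) := by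
    simp only [Finset.mul_sum]
    rw [Finset.sum_comm]
    refine Finset.sum_congr rfl fun y _ => ?_
    rw [Real.negMulLog, neg_mul]
    nth_rewrite 1 [outDist]
    rw [Finset.sum_mul, ← Finset.sum_neg_distrib]
    exact Finset.sum_congr rfl fun x _ => by ring
  rw [h, ← Finset.sum_add_distrib]
  refine Finset.sum_congr rfl fun x _ => ?_
  rw [← mul_add, ← Finset.sum_add_distrib]
  rcases (hP.1 x).eq_or_lt with hx | hx
  · simp [← hx]
  congr 1
  refine Finset.sum_congr rfl fun y _ => ?_
  rcases ((hW x).1 y).eq_or_lt with hy | hy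
  · simp [← hy]
  rw [Real.log_div hy.ne' (outDist_pos hW hP hx hy).ne']
  ring

lemma exists_isMax_mutInfo [Nonempty X] (hW : IsChannel W) :
    ∃ P, IsDist P ∧ ∀ P', IsDist P' → mutInfo P' W ≤ mutInfo P W := by
  classical
  have hmem : ∀ P : X → ℝ, P ∈ stdSimplex ℝ X ↔ IsDist P := fun P => Iff.rfl
  have hcont : ContinuousOn (fun P : X → ℝ => mutInfo P W) (stdSimplex ℝ X) := by
    have : Continuous (fun P : X → ℝ => ∑ x, P x * ∑ y, W x y * Real.log (W x y) +
        ∑ y, Real.negMulLog (outDist P W y)) := by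
      unfold outDist
      refine Continuous.add (by fun_prop) (continuous_finsetSum _ fun y _ => ?_)
      exact Real.continuous_negMulLog.comp (by fun_prop)
    exact this.continuousOn.congr fun P hP => mutInfo_eq hW ((hmem P).1 hP)
  obtain ⟨x⟩ := ‹Nonempty X›
  obtain ⟨P, hP, hmax⟩ := (isCompact_stdSimplex ℝ X).exists_isMaxOn
    ⟨_, single_mem_stdSimplex ℝ x⟩ hcont
  exact ⟨P, hP, fun P' hP' => hmax hP'⟩

lemma mutInfo_eq_capacity (hP : IsDist P) (hmax : ∀ P', IsDist P' → mutInfo P' W ≤ mutInfo P W) :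
    mutInfo P W = capacity W := by
  have : IsGreatest {c : ℝ | ∃ P : X → ℝ, IsDist P ∧ c = mutInfo P W} (mutInfo P W) :=
    ⟨⟨P, hP, rfl⟩, by rintro _ ⟨P', hP', rfl⟩; exact hmax P' hP'⟩
  exact this.csSup_eq.symm

lemma sum_mul_log_le_sum_mul_log {Z : Type*} [Fintype Z] {P Q : Z → ℝ} (hP : IsDist P)
    (hQ : IsDist Q) (hPQ : ∀ z, 0 < P z → 0 < Q z) :
    ∑ z, P z * Real.log (Q z) ≤ ∑ z, P z * Real.log (P z) := by
  have h : ∑ z, (P z * Real.log (Q z) - P z * Real.log (P z)) ≤ ∑ z, (Q z - P z) := by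
    refine Finset.sum_le_sum fun z _ => ?_
    rcases (hP.1 z).eq_or_lt with hz | hz
    · simp [← hz, hQ.1 z]
    have hq := hPQ z hz
    have := mul_le_mul_of_nonneg_left (Real.log_le_sub_one_of_pos (div_pos hq hz)) hz.le
    rw [Real.log_div hq.ne' hz.ne', mul_sub, mul_sub, mul_one, mul_div_cancel₀ _ hz.ne'] at this
    exact this
  rw [Finset.sum_sub_distrib, Finset.sum_sub_distrib, hP.2, hQ.2] at h
  linarith

/-- Optimality of `P` against mixtures of `P` with a point mass. -/
lemma sum_mul_log_sub_log_le (hW : IsChannel W) (hP : IsDist P)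
    (hmax : ∀ P', IsDist P' → mutInfo P' W ≤ mutInfo P W) (x : X) {t : ℝ} (ht : 0 < t)
    (ht1 : t < 1) :
    ∑ y, W x y * (Real.log (W x y) - Real.log ((1 - t) * outDist P W y + t * W x y)) ≤
      mutInfo P W := by
  classical
  let P' : X → ℝ := fun x' => (1 - t) * P x' + t * (if x' = x then 1 else 0)
  have hP' : IsDist P' := by
    refine ⟨fun x' => ?_, ?_⟩
    · have := hP.1 x'
      have h1 : 0 ≤ 1 - t := by linarith
      dsimp only [P']
      split_ifs <;> positivity
    · simp only [P', Finset.sum_add_distrib, ← Finset.mul_sum, hP.2]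
      simp
  have hlin : ∀ g : X → ℝ, ∑ x', P' x' * g x' = (1 - t) * ∑ x', P x' * g x' + t * g x := by
    intro g
    simp only [P', add_mul, Finset.sum_add_distrib, mul_assoc, ← Finset.mul_sum]
    simp
  have hQ' : ∀ y, outDist P' W y = (1 - t) * outDist P W y + t * W x y := fun y =>
    hlin fun x' => W x' y
  have hQd := isDist_outDist hW hP
  have hgibbs := sum_mul_log_le_sum_mul_log hQd (isDist_outDist hW hP') fun y hy => by
    rw [hQ']
    have := (hW x).1 y
    have h1 : 0 < 1 - t := by linarith
    positivity
  have hle := hmax P' hP'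
  rw [mutInfo_eq hW hP', hlin] at hle
  have hent : ∑ y, Real.negMulLog (outDist P' W y) =
      (1 - t) * -(∑ y, outDist P W y * Real.log (outDist P' W y)) +
        t * -(∑ y, W x y * Real.log (outDist P' W y)) := by
    rw [← Finset.sum_neg_distrib, ← Finset.sum_neg_distrib, Finset.mul_sum, Finset.mul_sum,
      ← Finset.sum_add_distrib]
    refine Finset.sum_congr rfl fun y _ => ?_
    rw [Real.negMulLog, hQ']
    ring
  have hI := mutInfo_eq hW hP
  have hnl : ∑ y, Real.negMulLog (outDist P W y) =
      -∑ y, outDist P W y * Real.log (outDist P W y) := by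
    rw [← Finset.sum_neg_distrib]
    exact Finset.sum_congr rfl fun y _ => by rw [Real.negMulLog]; ring
  simp only [← hQ', mul_sub, Finset.sum_sub_distrib]
  rw [hent] at hle
  rw [hnl] at hI
  have h1 : 0 ≤ 1 - t := by linarith
  have hg := mul_le_mul_of_nonneg_left hgibbs h1
  refine le_of_mul_le_mul_left ?_ ht
  have hI' : (1 - t) * mutInfo P W = (1 - t) * (∑ x, P x * ∑ y, W x y * Real.log (W x y)) +
      (1 - t) * -∑ y, outDist P W y * Real.log (outDist P W y) := by
    rw [hI]; ring
  linarith

/-- The capacity-achieving output distribution charges every output that some input can reach. -/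
lemma outDist_pos_of_isMax (hW : IsChannel W) (hP : IsDist P)
    (hmax : ∀ P', IsDist P' → mutInfo P' W ≤ mutInfo P W) {x : X} {y₀ : Y} (hxy : 0 < W x y₀) :
    0 < outDist P W y₀ := by
  by_contra hneg
  have hQd := isDist_outDist hW hP
  have hzero : outDist P W y₀ = 0 := le_antisymm (not_lt.1 hneg) (hQd.1 y₀)
  set A : ℝ := |mutInfo P W| + |∑ y, W x y * Real.log (W x y)| + 1 with hA
  have hA0 : 0 < A := by positivity
  set t : ℝ := Real.exp (-(A / W x y₀)) with ht
  have ht0 : 0 < t := Real.exp_pos _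
  have ht1 : t < 1 := by
    rw [ht, Real.exp_lt_one_iff]
    have := div_pos hA0 hxy
    linarith
  have h := sum_mul_log_sub_log_le hW hP hmax x ht0 ht1
  simp only [mul_sub, Finset.sum_sub_distrib] at h
  have hpos : ∀ y, 0 ≤ -(W x y * Real.log ((1 - t) * outDist P W y + t * W x y)) := by
    intro y
    have hw := (hW x).1 y
    have hw1 := (hW x).le_one y
    have hq := hQd.1 y
    have hq1 := hQd.le_one y
    have h1 : 0 ≤ 1 - t := by linarith
    rw [← mul_neg]
    refine mul_nonneg hw (neg_nonneg.2 (Real.log_nonpos (by positivity) ?_))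
    nlinarith
  have hterm : A ≤ -(W x y₀ * Real.log ((1 - t) * outDist P W y₀ + t * W x y₀)) := by
    rw [hzero, mul_zero, zero_add, Real.log_mul ht0.ne' hxy.ne', ht, Real.log_exp]
    have : Real.log (W x y₀) ≤ 0 := Real.log_nonpos hxy.le ((hW x).le_one y₀)
    have e : W x y₀ * (-(A / W x y₀)) = -A := by field_simp
    rw [mul_add, e]
    nlinarith
  have hs := Finset.single_le_sum (f := fun y =>
    -(W x y * Real.log ((1 - t) * outDist P W y + t * W x y))) (fun y _ => hpos y)
    (Finset.mem_univ y₀)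
  rw [Finset.sum_neg_distrib] at hs
  have a1 := le_abs_self (mutInfo P W)
  have a2 := neg_abs_le (∑ y, W x y * Real.log (W x y))
  linarith

lemma relEnt_le_of_isMax (hW : IsChannel W) (hP : IsDist P)
    (hmax : ∀ P', IsDist P' → mutInfo P' W ≤ mutInfo P W) (x : X) :
    relEnt (W x) (outDist P W) ≤ mutInfo P W := by
  have heq : relEnt (W x) (outDist P W) =
      ∑ y, W x y * (Real.log (W x y) - Real.log (outDist P W y)) := by
    refine Finset.sum_congr rfl fun y _ => ?_
    rcases ((hW x).1 y).eq_or_lt with hy | hy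
    · simp [← hy]
    rw [Real.log_div hy.ne' (outDist_pos_of_isMax hW hP hmax hy).ne']
  rw [heq]
  have hlim : Filter.Tendsto (fun t : ℝ => ∑ y, W x y * (Real.log (W x y) -
      Real.log ((1 - t) * outDist P W y + t * W x y))) (nhdsWithin 0 (Set.Ioi 0))
      (nhds (∑ y, W x y * (Real.log (W x y) - Real.log (outDist P W y)))) := by
    refine tendsto_finsetSum _ fun y _ => ?_
    rcases ((hW x).1 y).eq_or_lt with hy | hy
    · simp [← hy]
    refine Filter.Tendsto.const_mul _ (Filter.Tendsto.const_sub _ ?_)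
    refine Filter.Tendsto.log ?_ (outDist_pos_of_isMax hW hP hmax hy).ne'
    have hc : Continuous fun t : ℝ => (1 - t) * outDist P W y + t * W x y := by fun_prop
    have := hc.tendsto 0
    simp only [sub_zero, one_mul, zero_mul, add_zero] at this
    exact this.mono_left nhdsWithin_le_nhds
  refine le_of_tendsto hlim ?_
  filter_upwards [Ioo_mem_nhdsGT (zero_lt_one' ℝ)] with t ht
  exact sum_mul_log_sub_log_le hW hP hmax x ht.1 ht.2

/-- Existence of a distribution with the properties of the capacity-achieving output. -/
lemma exists_output_dist [Nonempty X] (hW : IsChannel W) :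
    ∃ Q : Y → ℝ, IsDist Q ∧ (∀ x y, 0 < W x y → 0 < Q y) ∧
      ∀ x, relEnt (W x) Q ≤ capacity W := by
  obtain ⟨P, hP, hmax⟩ := exists_isMax_mutInfo hW
  refine ⟨outDist P W, isDist_outDist hW hP, fun x y h => outDist_pos_of_isMax hW hP hmax h,
    fun x => ?_⟩
  rw [← mutInfo_eq_capacity hP hmax]
  exact relEnt_le_of_isMax hW hP hmax x

end Capacity

section Converse

variable {A B : Type*} [Fintype B] {V : A → B → ℝ}

/-- The information-spectrum converse bound for the average error probability. -/
lemma mul_le_of_tail_le {Q : B → ℝ} (hV : ∀ a b, 0 ≤ V a b) (hQ : IsDist Q)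
    {T : A → B → ℝ} {c Γ p ε : ℝ}
    (hT : ∀ a b, ¬ c < T a b → V a b ≤ Γ * Q b) (hΓ : 0 ≤ Γ)
    (hp : ∀ a, ∑ b, V a b * (if c < T a b then 1 else 0) ≤ p)
    {M : ℕ} (hM : 0 < M) (e : Fin M → A) (d : B → Fin M) (herr : avgErr V e d ≤ ε) :
    (M : ℝ) * (1 - ε - p) ≤ Γ := by
  have hM' : (0 : ℝ) < M := by exact_mod_cast hM
  have hm : ∀ m : Fin M, ∑ b ∈ univ.filter (fun b => d b = m), V (e m) b ≤
      p + Γ * ∑ b ∈ univ.filter (fun b => d b = m), Q b := by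
    intro m
    calc _ ≤ ∑ b ∈ univ.filter (fun b => d b = m),
          (V (e m) b * (if c < T (e m) b then 1 else 0) + Γ * Q b) := by
          refine Finset.sum_le_sum fun b _ => ?_
          split_ifs with h
          · have := mul_nonneg hΓ (hQ.1 b)
            linarith
          · simpa using hT _ _ h
      _ = ∑ b ∈ univ.filter (fun b => d b = m), V (e m) b * (if c < T (e m) b then 1 else 0) +
          Γ * ∑ b ∈ univ.filter (fun b => d b = m), Q b := by
          rw [Finset.sum_add_distrib, Finset.mul_sum]
      _ ≤ _ := by
          gcongr
          refine le_trans ?_ (hp (e m))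
          refine Finset.sum_le_sum_of_subset_of_nonneg (Finset.filter_subset _ _) fun b _ _ => ?_
          have := hV (e m) b
          split_ifs <;> simp [this]
  have hsum : ∑ m : Fin M, ∑ b ∈ univ.filter (fun b => d b = m), V (e m) b ≤ M * p + Γ := by
    calc _ ≤ ∑ m : Fin M, (p + Γ * ∑ b ∈ univ.filter (fun b => d b = m), Q b) :=
          Finset.sum_le_sum fun m _ => hm m
      _ = M * p + Γ * ∑ b, Q b := by
          rw [Finset.sum_add_distrib, ← Finset.mul_sum, Finset.sum_fiberwise]
          simp
      _ = _ := by rw [hQ.2, mul_one]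
  rw [avgErr] at herr
  have h1 : 1 - ε ≤ (1 / (M : ℝ)) * (M * p + Γ) := by
    have := mul_le_mul_of_nonneg_left hsum (by positivity : 0 ≤ 1 / (M : ℝ))
    linarith
  have h2 := mul_le_mul_of_nonneg_left h1 hM'.le
  have h3 : (M : ℝ) * ((1 / (M : ℝ)) * (M * p + Γ)) = M * p + Γ := by field_simp
  linarith

lemma log_Mstar_le [Nonempty A] [Nonempty B] (hV : ∀ a, IsDist (V a)) {ε γ : ℝ} (hε : 0 ≤ ε)
    (h : ∀ M : ℕ, 0 < M → ∀ (e : Fin M → A) (d : B → Fin M), avgErr V e d ≤ ε →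
      (M : ℝ) ≤ Real.exp γ) :
    Real.log (Mstar V ε) ≤ γ := by
  have hpos : ∀ {M : ℕ}, (B → Fin M) → 0 < M := fun d =>
    (Nat.zero_le _).trans_lt (d (Classical.arbitrary B)).isLt
  set S : Set ℕ := {M : ℕ | ∃ e : Fin M → A, ∃ d : B → Fin M, avgErr V e d ≤ ε} with hS
  have hne : S.Nonempty := by
    refine ⟨1, fun _ => Classical.arbitrary A, fun _ => 0, ?_⟩
    have : ∀ m : Fin 1, univ.filter (fun _ : B => (0 : Fin 1) = m) = univ := fun m => by
      rw [Subsingleton.elim m 0]; simp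
    simp only [avgErr, this, (hV _).2]
    simpa using hε
  have hbdd : BddAbove S := by
    refine ⟨⌊Real.exp γ⌋₊, ?_⟩
    rintro M ⟨e, d, hed⟩
    exact Nat.le_floor (h M (hpos d) e d hed)
  obtain ⟨e, d, hed⟩ := Nat.sSup_mem hne hbdd
  have hM := hpos d
  have := h _ hM e d hed
  rw [Mstar, Real.log_le_iff_le_exp (by exact_mod_cast hM)]
  exact this

end Converse

/-- For an exotic DMC `W` (so in particular `V_max = 0`), at `ε = 1/2`,
`log M*(Wⁿ, 1/2) ≤ n C + (1/2) log n + K` for some constant `K`. -/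
theorem converse_eps_half_exotic
    {X Y : Type*} [Fintype X] [Fintype Y] [Nonempty X] [Nonempty Y]
    (W : X → Y → ℝ) (hW : IsChannel W) (hexo : IsExotic W) :
    ∃ K : ℝ, ∀ n : ℕ, 1 ≤ n →
      Real.log (Mstar (fun (xs : Fin n → X) (ys : Fin n → Y) => ∏ i, W (xs i) (ys i)) (1/2)) ≤
        (n : ℝ) * capacity W + (1 / 2) * Real.log n + K := by
  obtain ⟨Q, hQ, hsupp, hD⟩ := exists_output_dist hW
  let ξ : X → Y → ℝ := fun x y => Real.log (W x y / Q y) - relEnt (W x) Q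
  obtain ⟨c, hc⟩ := exists_prodExp_tail_le (Z := Y) (∑ x, ∑ y, |ξ x y|)
  have hbound : ∀ x y, |ξ x y| ≤ ∑ x, ∑ y, |ξ x y| := fun x y =>
    (Finset.single_le_sum (f := fun y => |ξ x y|) (fun _ _ => abs_nonneg _)
      (Finset.mem_univ y)).trans
    (Finset.single_le_sum (f := fun x => ∑ y, |ξ x y|)
      (fun _ _ => Finset.sum_nonneg fun _ _ => abs_nonneg _) (Finset.mem_univ x))
  have hmean : ∀ x, ∑ y, W x y * ξ x y = 0 := by
    intro x
    simp only [ξ, mul_sub, Finset.sum_sub_distrib, ← Finset.sum_mul, (hW x).2, one_mul]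
    exact sub_self _
  refine ⟨c + Real.log 4, fun n hn => ?_⟩
  have hn0 : (0 : ℝ) < n := by exact_mod_cast hn
  have hs0 : 0 < Real.sqrt n := Real.sqrt_pos.2 hn0
  have hWn : ∀ xs : Fin n → X, IsDist (fun ys : Fin n → Y => ∏ i, W (xs i) (ys i)) := fun xs =>
    ⟨fun ys => Finset.prod_nonneg fun i _ => (hW _).1 _,
      sum_prod_eq_one (w := fun i => W (xs i)) fun i => hW (xs i)⟩
  refine log_Mstar_le hWn (by norm_num) fun M hM e d herr => ?_
  have hlik : ∀ (xs : Fin n → X) (ys : Fin n → Y), ¬ c < ∑ i, ξ (xs i) (ys i) →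
      ∏ i, W (xs i) (ys i) ≤ Real.exp (n * capacity W + c) * ∏ i, Q (ys i) := by
    intro xs ys hle
    have hQ0 : 0 ≤ ∏ i, Q (ys i) := Finset.prod_nonneg fun i _ => hQ.1 _
    by_cases hpos : ∀ i, 0 < W (xs i) (ys i)
    · have e1 : ∏ i, W (xs i) (ys i) =
          Real.exp (∑ i, Real.log (W (xs i) (ys i) / Q (ys i))) * ∏ i, Q (ys i) := by
        rw [Real.exp_sum, ← Finset.prod_mul_distrib]
        refine Finset.prod_congr rfl fun i _ => ?_
        have hq := hsupp _ _ (hpos i)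
        rw [Real.exp_log (div_pos (hpos i) hq), div_mul_cancel₀ _ hq.ne']
      rw [e1]
      refine mul_le_mul_of_nonneg_right (Real.exp_le_exp.2 ?_) hQ0
      have h1 : ∑ i, Real.log (W (xs i) (ys i) / Q (ys i)) =
          ∑ i, ξ (xs i) (ys i) + ∑ i, relEnt (W (xs i)) Q := by
        rw [← Finset.sum_add_distrib]
        exact Finset.sum_congr rfl fun i _ => by simp only [ξ]; ring
      have h2 : ∑ i, relEnt (W (xs i)) Q ≤ n * capacity W := by
        calc _ ≤ ∑ _i : Fin n, capacity W := Finset.sum_le_sum fun i _ => hD _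
          _ = _ := by simp
      linarith
    · obtain ⟨i, hi⟩ := not_forall.1 hpos
      rw [Finset.prod_eq_zero (Finset.mem_univ i) (le_antisymm (not_lt.1 hi) ((hW _).1 _))]
      positivity
  have htail : ∀ xs : Fin n → X, ∑ ys : Fin n → Y, (∏ i, W (xs i) (ys i)) *
      (if c < ∑ i, ξ (xs i) (ys i) then 1 else 0) ≤ 1 / 2 - 1 / (4 * Real.sqrt n) := fun xs =>
    hc n hn (fun i => W (xs i)) (fun i => ξ (xs i)) (fun i => hW _) (fun i => hmean _)
      fun i => hbound _
  have hQn : IsDist (fun ys : Fin n → Y => ∏ i, Q (ys i)) :=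
    ⟨fun ys => Finset.prod_nonneg fun i _ => hQ.1 _, sum_prod_eq_one (w := fun _ => Q) fun _ => hQ⟩
  have hconv := mul_le_of_tail_le (V := fun (xs : Fin n → X) (ys : Fin n → Y) =>
    ∏ i, W (xs i) (ys i)) (T := fun xs ys => ∑ i, ξ (xs i) (ys i))
    (fun xs => (hWn xs).1) hQn hlik (Real.exp_pos _).le
    htail hM e d herr
  have e1 : Real.exp (n * capacity W + 1 / 2 * Real.log n + (c + Real.log 4)) =
      4 * Real.sqrt n * Real.exp (n * capacity W + c) := by
    have hsq : Real.exp (1 / 2 * Real.log n) = Real.sqrt n := by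
      rw [Real.sqrt_eq_rpow, Real.rpow_def_of_pos hn0, mul_comm]
    rw [show (n * capacity W + 1 / 2 * Real.log n + (c + Real.log 4) : ℝ) =
      Real.log 4 + 1 / 2 * Real.log n + (n * capacity W + c) by ring, Real.exp_add, Real.exp_add,
      Real.exp_log (by norm_num), hsq]
  rw [e1]
  have e2 : (M : ℝ) = 4 * Real.sqrt n * (M * (1 - 1 / 2 - (1 / 2 - 1 / (4 * Real.sqrt n)))) := by
    field_simp
    ring
  rw [e2]
  exact mul_le_mul_of_nonneg_left hconv (by positivity)
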